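/- There exists a constant c such that every binary stream X is computable from some binary stream Y with oracle-use n ↦ K(X↾n) + c·(⌊√n⌋ + 1). -/

import Mathlib

open scoped ENNReal

abbrev BStr := List Bool

/-- The first `n` bits of the stream `X`, as a binary string. -/
def stake (X : ℕ → Bool) (n : ℕ) : BStr := (List.range n).map X

/-- A set of binary strings is prefix-free if no element is a proper prefix of another. -/
def PrefixFreeSet (S : Set BStr) : Prop :=
  ∀ σ ∈ S, ∀ τ ∈ S, σ <+: τ → σ = τ

/-- `X` is computable from `Y` with oracle-use `f`. -/
def ComputableWithUse (X Y : ℕ → Bool) (f : ℕ → ℕ) : Prop :=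
  ∃ F : ℕ × BStr →. BStr, Partrec F ∧ ∀ n, stake X n ∈ F (n, stake Y (f n))

/-- A prefix-free machine: partial computable with prefix-free domain. -/
def PrefixFreeMachine (M : BStr →. BStr) : Prop :=
  Partrec M ∧ PrefixFreeSet {ρ | (M ρ).Dom}

/-- `K_M σ`: least length of an `M`-description of `σ` (`⊤` if none). -/
noncomputable def KM (M : BStr →. BStr) (σ : BStr) : ℕ∞ :=
  sInf ((fun ρ : BStr => (ρ.length : ℕ∞)) '' {ρ | σ ∈ M ρ})

/-- Universal prefix-free machine. -/
def UniversalPFM (U : BStr →. BStr) : Prop :=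
  PrefixFreeMachine U ∧
    ∀ M : BStr →. BStr, PrefixFreeMachine M →
      ∃ c : ℕ, ∀ σ, KM U σ ≤ KM M σ + (c : ℕ∞)

/-- Prefix-free Kolmogorov complexity w.r.t. `U`, as a natural number. -/
noncomputable def Kof (U : BStr →. BStr) (σ : BStr) : ℕ := (KM U σ).toNat

/-- Martin-Löf randomness via Schnorr's characterization: `K(Y↾n) ≥ n - c`. -/
def MLRandom (U : BStr →. BStr) (Y : ℕ → Bool) : Prop :=
  ∃ c : ℕ, ∀ n, n ≤ Kof U (stake Y n) + c

/-- The weight `2^{-I(σ)}` contributed by `σ` (zero if `I σ` is undefined). -/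
noncomputable def iweight (I : BStr →. ℕ) (σ : BStr) : ℝ≥0∞ :=
  haveI := Classical.propDecidable (I σ).Dom
  if h : (I σ).Dom then ((2 : ℝ≥0∞) ^ ((I σ).get h))⁻¹ else 0

/-! ### Online interval allocation (effective Kraft–Chaitin) -/

/-- The weight `2^{-ℓ}` of an optional length `ℓ`. -/
noncomputable def lenWeight : Option ℕ → ℝ
  | none => 0
  | some ℓ => (1 / 2) ^ ℓ

/-- The total weight of the first `t` entries of a sequence of optional lengths. -/
noncomputable def weightSum (f : ℕ → Option ℕ) (t : ℕ) : ℝ :=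
  ∑ s ∈ Finset.range t, lenWeight (f s)

/-- A pair `(a, e)` of naturals with `a / 2 ^ e = weightSum f t`. -/
def dyadicSum (f : ℕ → Option ℕ) (t : ℕ) : ℕ × ℕ :=
  Nat.rec (0, 0) (fun s p =>
    Option.casesOn (f s) p (fun ℓ => (p.1 * 2 ^ ℓ + 2 ^ p.2, p.2 + ℓ))) t

/-- The index, among dyadic intervals of length `2^{-(ℓ+1)}`, of the one allocated to entry `t`. -/
def slot (f : ℕ → Option ℕ) (t ℓ : ℕ) : ℕ :=
  (dyadicSum f t).1 * 2 ^ (ℓ + 1) / 2 ^ (dyadicSum f t).2 + 1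

/-- The natural number with binary expansion `p`. -/
def binVal (p : BStr) : ℕ := p.foldl (fun n b => 2 * n + cond b 1 0) 0

/-- `p` is the code word allocated to entry `t` of the sequence `f` of lengths. -/
def isCode (f : ℕ → Option ℕ) (t : ℕ) (p : BStr) : Bool :=
  Option.casesOn (f t) false (fun ℓ => decide (p.length = ℓ + 1 ∧ binVal p = slot f t ℓ))

lemma lenWeight_nonneg (o : Option ℕ) : 0 ≤ lenWeight o := by
  cases o <;> simp [lenWeight]

lemma weightSum_nonneg (f : ℕ → Option ℕ) (t : ℕ) : 0 ≤ weightSum f t :=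
  Finset.sum_nonneg fun s _ => lenWeight_nonneg (f s)

lemma weightSum_succ (f : ℕ → Option ℕ) (t : ℕ) :
    weightSum f (t + 1) = weightSum f t + lenWeight (f t) := by
  simp [weightSum, Finset.sum_range_succ]

lemma weightSum_mono (f : ℕ → Option ℕ) : Monotone (weightSum f) :=
  monotone_nat_of_le_succ fun t => by
    rw [weightSum_succ]; linarith [lenWeight_nonneg (f t)]

lemma dyadicSum_eq (f : ℕ → Option ℕ) (t : ℕ) :
    ((dyadicSum f t).1 : ℝ) = weightSum f t * 2 ^ (dyadicSum f t).2 := by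
  induction t with
  | zero => simp [dyadicSum, weightSum]
  | succ t ih =>
    rw [weightSum_succ]
    have h : dyadicSum f (t + 1) = Option.casesOn (f t) (dyadicSum f t)
      (fun ℓ => ((dyadicSum f t).1 * 2 ^ ℓ + 2 ^ (dyadicSum f t).2, (dyadicSum f t).2 + ℓ)) := rfl
    rw [h]
    cases f t with
    | none => simpa [lenWeight] using ih
    | some ℓ =>
      simp only [lenWeight]
      push_cast
      rw [ih, pow_add, one_div, inv_pow]
      field_simp

lemma weightSum_lt_slot (f : ℕ → Option ℕ) (t ℓ : ℕ) :
    weightSum f t * 2 ^ (ℓ + 1) < slot f t ℓ := by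
  have h := Nat.lt_div_mul_add (a := (dyadicSum f t).1 * 2 ^ (ℓ + 1))
    (b := 2 ^ (dyadicSum f t).2) (by positivity)
  have h' : ((dyadicSum f t).1 : ℝ) * 2 ^ (ℓ + 1) < slot f t ℓ * 2 ^ (dyadicSum f t).2 := by
    have : (dyadicSum f t).1 * 2 ^ (ℓ + 1) < slot f t ℓ * 2 ^ (dyadicSum f t).2 := by
      unfold slot; linarith
    exact_mod_cast this
  rw [dyadicSum_eq] at h'
  have hp : (0 : ℝ) < 2 ^ (dyadicSum f t).2 := by positivity
  nlinarith

lemma slot_le (f : ℕ → Option ℕ) (t ℓ : ℕ) :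
    (slot f t ℓ : ℝ) ≤ weightSum f t * 2 ^ (ℓ + 1) + 1 := by
  have h := Nat.div_mul_le_self ((dyadicSum f t).1 * 2 ^ (ℓ + 1)) (2 ^ (dyadicSum f t).2)
  have h' : ((((dyadicSum f t).1 * 2 ^ (ℓ + 1) / 2 ^ (dyadicSum f t).2 : ℕ) : ℝ)) *
      2 ^ (dyadicSum f t).2 ≤ (dyadicSum f t).1 * 2 ^ (ℓ + 1) := by exact_mod_cast h
  rw [dyadicSum_eq] at h'
  have hp : (0 : ℝ) < 2 ^ (dyadicSum f t).2 := by positivity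
  unfold slot
  push_cast
  nlinarith

lemma binVal_append (p q : BStr) : binVal (p ++ q) = binVal p * 2 ^ q.length + binVal q := by
  induction q using List.reverseRecOn with
  | nil => simp [binVal]
  | append_singleton q b ih =>
    have h (r : BStr) : binVal (r ++ [b]) = 2 * binVal r + cond b 1 0 := by simp [binVal]
    rw [← List.append_assoc, h, h, ih]
    simp [pow_succ]
    ring

lemma binVal_lt (p : BStr) : binVal p < 2 ^ p.length := by
  induction p using List.reverseRecOn with
  | nil => simp [binVal]
  | append_singleton p b ih =>
    have h : binVal [b] = cond b 1 0 := by simp [binVal]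
    rw [binVal_append, h]
    cases b <;> simp [pow_succ] <;> omega

lemma exists_binVal_eq (n v : ℕ) (hv : v < 2 ^ n) : ∃ p : BStr, p.length = n ∧ binVal p = v := by
  induction n generalizing v with
  | zero => exact ⟨[], rfl, by simp at hv; simp [binVal, hv]⟩
  | succ n ih =>
    obtain ⟨p, hp, hpv⟩ := ih (v / 2) (by rw [pow_succ] at hv; omega)
    refine ⟨p ++ [decide (v % 2 = 1)], by simp [hp], ?_⟩
    rw [binVal_append, hpv]
    rcases Nat.mod_two_eq_zero_or_one v with h | h <;> simp [binVal, h] <;> omega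

lemma isCode_iff {f : ℕ → Option ℕ} {t : ℕ} {p : BStr} :
    isCode f t p = true ↔ ∃ ℓ, f t = some ℓ ∧ p.length = ℓ + 1 ∧ binVal p = slot f t ℓ := by
  unfold isCode
  cases f t <;> simp

lemma exists_isCode {f : ℕ → Option ℕ} {t ℓ : ℕ} (hf : f t = some ℓ)
    (hs : weightSum f (t + 1) ≤ 1) : ∃ p, p.length = ℓ + 1 ∧ isCode f t p = true := by
  have hlt : slot f t ℓ < 2 ^ (ℓ + 1) := by
    have h := slot_le f t ℓ
    rw [weightSum_succ, hf, lenWeight] at hs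
    have hp : (0 : ℝ) < 2 ^ (ℓ + 1) := by positivity
    have h2 : ((1 : ℝ) / 2) ^ ℓ * 2 ^ (ℓ + 1) = 2 := by
      rw [one_div, inv_pow, pow_succ]; field_simp
    have : (slot f t ℓ : ℝ) < 2 ^ (ℓ + 1) := by nlinarith
    exact_mod_cast this
  obtain ⟨p, hp, hpv⟩ := exists_binVal_eq _ _ hlt
  exact ⟨p, hp, isCode_iff.2 ⟨ℓ, hf, hp, hpv⟩⟩

lemma isCode_unique {f : ℕ → Option ℕ} {t t' : ℕ} {p p' : BStr} (hc : isCode f t p = true)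
    (hc' : isCode f t' p' = true) (hp : p <+: p') : t = t' := by
  obtain ⟨ℓ, hf, hl, hv⟩ := isCode_iff.1 hc
  obtain ⟨ℓ', hf', hl', hv'⟩ := isCode_iff.1 hc'
  obtain ⟨q, rfl⟩ := hp
  have h1 : (binVal (p ++ q) : ℝ) = binVal p * 2 ^ q.length + binVal q := by
    exact_mod_cast binVal_append p q
  have h2 : (binVal q : ℝ) + 1 ≤ 2 ^ q.length := by exact_mod_cast binVal_lt q
  have h2' : (0 : ℝ) ≤ binVal q := by positivity
  have hpow : (2 : ℝ) ^ (ℓ' + 1) = 2 ^ (ℓ + 1) * 2 ^ q.length := by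
    rw [← hl', ← hl, List.length_append, pow_add]
  have key (u m : ℕ) (hu : f u = some m) (v : ℕ) (huv : u < v) :
      weightSum f u * 2 ^ (m + 1) + 2 ≤ weightSum f v * 2 ^ (m + 1) := by
    have h := weightSum_mono f (show u + 1 ≤ v from huv)
    rw [weightSum_succ, hu, lenWeight] at h
    have hp : (0 : ℝ) < 2 ^ (m + 1) := by positivity
    have h2 : ((1 : ℝ) / 2) ^ m * 2 ^ (m + 1) = 2 := by
      rw [one_div, inv_pow, pow_succ]; field_simp
    nlinarith
  have a1 := weightSum_lt_slot f t ℓ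
  have a2 := slot_le f t ℓ
  have b1 := weightSum_lt_slot f t' ℓ'
  have b2 := slot_le f t' ℓ'
  rw [← hv] at a1 a2
  rw [← hv', h1, hpow] at b1 b2
  have hQ : (0 : ℝ) < 2 ^ q.length := by positivity
  rcases lt_trichotomy t t' with h | h | h
  · exfalso
    have k := key t ℓ hf t' h
    nlinarith
  · exact h
  · exfalso
    have k := key t' ℓ' hf' t h
    rw [hpow] at k
    nlinarith

section Computability

variable {α : Type*} [Primcodable α]

lemma primrec_two_pow : Primrec (fun n : ℕ => 2 ^ n) := by
  have h : Primrec₂ (fun a b : ℕ => a ^ b) := Primrec₂.unpaired'.1 Nat.Primrec.pow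
  exact h.comp (Primrec.const 2) Primrec.id

lemma primrec_dyadicSum {f : α → ℕ → Option ℕ} (hf : Primrec₂ f) :
    Primrec₂ (fun a t => dyadicSum (f a) t) := by
  unfold dyadicSum
  refine Primrec.nat_rec (g := fun a (x : ℕ × ℕ × ℕ) => Option.casesOn (f a x.1) x.2
    (fun ℓ => (x.2.1 * 2 ^ ℓ + 2 ^ x.2.2, x.2.2 + ℓ))) (Primrec.const (0, 0)) ?_
  refine Primrec.option_casesOn (hf.comp Primrec.fst (Primrec.fst.comp Primrec.snd))
    (Primrec.snd.comp Primrec.snd) ?_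
  have hp : Primrec (fun x : (α × ℕ × ℕ × ℕ) × ℕ => x.1.2.2) :=
    Primrec.snd.comp (Primrec.snd.comp Primrec.fst)
  exact Primrec.pair
    (Primrec.nat_add.comp
      (Primrec.nat_mul.comp (Primrec.fst.comp hp) (primrec_two_pow.comp Primrec.snd))
      (primrec_two_pow.comp (Primrec.snd.comp hp)))
    (Primrec.nat_add.comp (Primrec.snd.comp hp) Primrec.snd)

lemma primrec_binVal : Primrec binVal := by
  refine Primrec.list_foldl (h := fun _ (x : ℕ × Bool) => 2 * x.1 + cond x.2 1 0) Primrec.id (Primrec.const 0) ?_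
  exact Primrec.nat_add.comp
    (Primrec.nat_mul.comp (Primrec.const 2) (Primrec.fst.comp Primrec.snd))
    (Primrec.cond (Primrec.snd.comp Primrec.snd) (Primrec.const 1) (Primrec.const 0))

lemma primrec_isCode {f : α → ℕ → Option ℕ} (hf : Primrec₂ f) :
    Primrec (fun x : α × ℕ × BStr => isCode (f x.1) x.2.1 x.2.2) := by
  unfold isCode
  refine Primrec.option_casesOn (hf.comp Primrec.fst (Primrec.fst.comp Primrec.snd))
    (Primrec.const false) ?_
  have hd : Primrec (fun x : (α × ℕ × BStr) × ℕ => dyadicSum (f x.1.1) x.1.2.1) :=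
    (primrec_dyadicSum hf).comp (Primrec.fst.comp Primrec.fst)
      (Primrec.fst.comp (Primrec.snd.comp Primrec.fst))
  have hl : Primrec (fun x : (α × ℕ × BStr) × ℕ => x.2 + 1) := Primrec.succ.comp Primrec.snd
  have hs : Primrec (fun x : (α × ℕ × BStr) × ℕ => slot (f x.1.1) x.1.2.1 x.2) :=
    Primrec.succ.comp (Primrec.nat_div.comp
      (Primrec.nat_mul.comp (Primrec.fst.comp hd) (primrec_two_pow.comp hl))
      (primrec_two_pow.comp (Primrec.snd.comp hd)))
  have hq : Primrec (fun x : (α × ℕ × BStr) × ℕ => x.1.2.2) :=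
    Primrec.snd.comp (Primrec.snd.comp Primrec.fst)
  exact (PrimrecPred.and (Primrec.eq.comp (Primrec.list_length.comp hq) hl)
    (Primrec.eq.comp (primrec_binVal.comp hq) hs)).decide

end Computability

/-- **Kraft–Chaitin**: a primitive recursive sequence of requests of total weight at most `1` is
served by a prefix-free machine, hence by the universal one. -/
lemma UniversalPFM.exists_forall_KM_le {U : BStr →. BStr} (hU : UniversalPFM U)
    {r : ℕ → Option (ℕ × BStr)} (hr : Primrec r)
    (hw : ∀ t, weightSum (fun s => (r s).map Prod.fst) t ≤ 1) :
    ∃ c : ℕ, ∀ t ℓ σ, r t = some (ℓ, σ) → KM U σ ≤ (ℓ + c : ℕ) := by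
  set f : ℕ → Option ℕ := fun s => (r s).map Prod.fst with hfdef
  have hf : Primrec₂ (fun (_ : Unit) s => f s) :=
    Primrec.option_map (hr.comp Primrec.snd) (Primrec.fst.comp Primrec.snd)
  let g : BStr → ℕ → Option BStr := fun p t => if isCode f t p then (r t).map Prod.snd else none
  have hg : Primrec₂ g := by
    refine Primrec.ite (c := fun x : BStr × ℕ => isCode f x.2 x.1 = true) ?_
      (Primrec.option_map (hr.comp Primrec.snd) (Primrec.snd.comp Primrec.snd)) (Primrec.const none)
    exact Primrec.eq.comp ((primrec_isCode hf).comp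
      (Primrec.pair (Primrec.const ()) (Primrec.pair Primrec.snd Primrec.fst))) (Primrec.const true)
  let M : BStr →. BStr := fun p => Nat.rfindOpt (g p)
  have hspec {p : BStr} {t : ℕ} {σ : BStr} (h : σ ∈ g p t) :
      isCode f t p = true ∧ (r t).map Prod.snd = some σ := by
    simp only [g] at h
    split_ifs at h with hc
    · exact ⟨hc, h⟩
    · simp at h
  have hM : PrefixFreeMachine M := by
    refine ⟨Partrec.rfindOpt hg.to_comp, fun p hp p' hp' hpp => ?_⟩
    obtain ⟨t, σ, ht⟩ := Nat.rfindOpt_dom.1 hp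
    obtain ⟨t', σ', ht'⟩ := Nat.rfindOpt_dom.1 hp'
    have h1 := (hspec ht).1
    have h2 := (hspec ht').1
    obtain rfl := isCode_unique h1 h2 hpp
    obtain ⟨ℓ, e1, e2, -⟩ := isCode_iff.1 h1
    obtain ⟨ℓ', e1', e2', -⟩ := isCode_iff.1 h2
    rw [e1] at e1'
    cases e1'
    exact hpp.eq_of_length (by omega)
  obtain ⟨c, hc⟩ := hU.2 M hM
  refine ⟨c + 1, fun t ℓ σ h => (hc σ).trans ?_⟩
  obtain ⟨p, hp, hpc⟩ := exists_isCode (f := f) (t := t) (ℓ := ℓ) (by simp [hfdef, h]) (hw _)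
  have hmem : σ ∈ g p t := by simp [g, hpc, h]
  have hM' : σ ∈ M p := by
    obtain ⟨τ, hτ⟩ := Part.dom_iff_mem.1 (Nat.rfindOpt_dom.2 ⟨t, σ, hmem⟩)
    obtain ⟨t', ht'⟩ := Nat.rfindOpt_spec hτ
    obtain ⟨hc', hr'⟩ := hspec ht'
    obtain rfl := isCode_unique hpc hc' (List.prefix_refl p)
    rw [h] at hr'
    cases hr'
    exact hτ
  have : KM M σ ≤ (ℓ + 1 : ℕ) := sInf_le ⟨p, hM', by simp [hp]⟩
  calc KM M σ + c ≤ (ℓ + 1 : ℕ) + (c : ℕ∞) := by gcongr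
    _ = (ℓ + (c + 1) : ℕ) := by push_cast; ring

/-! ### Enumerating a prefix-free machine -/

lemma PrefixFreeSet.sum_le_one {S : Finset BStr} (hS : PrefixFreeSet (S : Set BStr)) :
    ∑ ρ ∈ S, (1 / 2 : ℝ) ^ ρ.length ≤ 1 := by
  by_cases h0 : ([] : BStr) ∈ S
  · have : S = {[]} := Finset.eq_singleton_iff_unique_mem.2
      ⟨h0, fun τ hτ => (hS [] h0 τ hτ List.nil_prefix).symm⟩
    simp [this]
  · have hU : InformationTheory.UniquelyDecodable (S : Set BStr) := by
      intro L₁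
      induction L₁ with
      | nil =>
        rintro (_ | ⟨w, L₂⟩) - h₂ h
        · rfl
        · have : w = [] := by simp_all
          exact absurd (this ▸ h₂ w (by simp)) h0
      | cons v L₁ ih =>
        rintro (_ | ⟨w, L₂⟩) h₁ h₂ h
        · have : v = [] := by simp_all
          exact absurd (this ▸ h₁ v (by simp)) h0
        · have hv := h₁ v (by simp)
          have hw := h₂ w (by simp)
          simp only [List.flatten_cons] at h
          have hvw : v = w := by
            rcases List.prefix_or_prefix_of_prefix (List.prefix_append v L₁.flatten)
              (h ▸ List.prefix_append w L₂.flatten) with hp | hp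
            · exact hS v hv w hw hp
            · exact (hS w hw v hv hp).symm
          subst hvw
          rw [ih L₂ (fun x hx => h₁ x (by simp [hx])) (fun x hx => h₂ x (by simp [hx]))
            (List.append_cancel_left h)]
    simpa using InformationTheory.kraft_mcmillan_inequality hU

/-- The domain of a prefix-free machine can be enumerated primitive recursively, listing the length
and the output of every halting program exactly once. -/
lemma PrefixFreeMachine.exists_enum {U : BStr →. BStr} (hU : PrefixFreeMachine U) :
    ∃ e : ℕ → Option (ℕ × BStr), Primrec e ∧
      (∀ t, weightSum (fun s => (e s).map Prod.fst) t ≤ 1) ∧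
      ∀ ρ τ, τ ∈ U ρ → ∃ s, e s = some (ρ.length, τ) := by
  obtain ⟨c, hc⟩ := Nat.Partrec.Code.exists_code.1 hU.1
  have hev (ρ τ : BStr) : Encodable.encode τ ∈ c.eval (Encodable.encode ρ) ↔ τ ∈ U ρ := by
    rw [hc]; simp
  let prog : ℕ → BStr := fun s => ((Encodable.decode s.unpair.2 : Option BStr)).getD []
  let v : ℕ → ℕ → Option ℕ := fun k s => Nat.Partrec.Code.evaln k c (Encodable.encode (prog s))
  let e : ℕ → Option (ℕ × BStr) := fun s =>
    if v s.unpair.1 s = none ∧ Encodable.encode (prog s) = s.unpair.2 then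
      (v (s.unpair.1 + 1) s).map (fun y => ((prog s).length, (Encodable.decode y : Option BStr).getD []))
    else none
  have hdec : Primrec (fun n : ℕ => (Encodable.decode n : Option BStr).getD []) :=
    Primrec.option_getD.comp Primrec.decode (Primrec.const [])
  have hprog : Primrec prog := hdec.comp (Primrec.snd.comp Primrec.unpair)
  have hv : Primrec₂ v := Nat.Partrec.Code.primrec_evaln.comp
    (Primrec.pair (Primrec.pair Primrec.fst (Primrec.const c))
      (Primrec.encode.comp (hprog.comp Primrec.snd)))
  have hfst : Primrec (fun s : ℕ => s.unpair.1) := Primrec.fst.comp Primrec.unpair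
  have he : Primrec e := by
    refine Primrec.ite (c := fun s : ℕ => v s.unpair.1 s = none ∧ Encodable.encode (prog s) = s.unpair.2)
      (PrimrecPred.and (Primrec.eq.comp (hv.comp hfst Primrec.id) (Primrec.const none))
        (Primrec.eq.comp (Primrec.encode.comp hprog) (Primrec.snd.comp Primrec.unpair)))
      ?_ (Primrec.const none)
    exact Primrec.option_map (hv.comp (Primrec.succ.comp hfst) Primrec.id)
      (Primrec.pair (Primrec.list_length.comp (hprog.comp Primrec.fst))
        (hdec.comp Primrec.snd))
  have hspec {s ℓ : ℕ} {τ : BStr} (h : e s = some (ℓ, τ)) :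
      (prog s).length = ℓ ∧ (U (prog s)).Dom ∧ v s.unpair.1 s = none ∧
        (v (s.unpair.1 + 1) s).isSome ∧ Encodable.encode (prog s) = s.unpair.2 := by
    simp only [e] at h
    split_ifs at h with h1
    obtain ⟨y, hy, hy'⟩ := Option.map_eq_some_iff.1 h
    cases hy'
    refine ⟨rfl, ?_, h1.1, by simp [hy], h1.2⟩
    have := Nat.Partrec.Code.evaln_sound hy
    rw [hc] at this
    simp only [Encodable.encodek, Part.coe_some, Part.bind_some, Part.mem_map_iff] at this
    obtain ⟨a, ha, -⟩ := this
    exact Part.dom_iff_mem.2 ⟨a, ha⟩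
  refine ⟨e, he, fun t => ?_, fun ρ τ hτ => ?_⟩
  · let A := (Finset.range t).filter (fun s => (e s).isSome)
    have hA {s : ℕ} (hs : s ∈ A) : ∃ ℓ τ, e s = some (ℓ, τ) := by
      obtain ⟨⟨ℓ, τ⟩, h⟩ := Option.isSome_iff_exists.1 (Finset.mem_filter.1 hs).2
      exact ⟨ℓ, τ, h⟩
    have hinj : Set.InjOn prog A := by
      intro s hs s' hs' hss
      obtain ⟨ℓ, τ, h⟩ := hA hs
      obtain ⟨ℓ', τ', h'⟩ := hA hs'
      obtain ⟨-, -, h2, h3, h4⟩ := hspec h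
      obtain ⟨-, -, h2', h3', h4'⟩ := hspec h'
      have hmono {i j : ℕ} {x : ℕ} (hij : i ≤ j) (hi : (v i x).isSome) (hj : v j x = none) :
          False := by
        obtain ⟨y, hy⟩ := Option.isSome_iff_exists.1 hi
        have hy' : y ∈ v j x := Nat.Partrec.Code.evaln_mono hij hy
        rw [hj] at hy'
        simp at hy'
      have hvv (k : ℕ) : v k s' = v k s := by simp only [v, hss]
      rw [hvv] at h2' h3'
      have hk : s.unpair.1 = s'.unpair.1 := by
        rcases lt_trichotomy s.unpair.1 s'.unpair.1 with hlt | heq | hlt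
        · exact (hmono hlt h3 h2').elim
        · exact heq
        · exact (hmono hlt h3' h2).elim
      have hp : s.unpair.2 = s'.unpair.2 := by rw [← h4, ← h4', hss]
      rw [← Nat.pair_unpair s, ← Nat.pair_unpair s', hk, hp]
    have hpf : PrefixFreeSet ((A.image prog : Finset BStr) : Set BStr) := by
      intro σ hσ σ' hσ' hp
      obtain ⟨s, hs, rfl⟩ := Finset.mem_image.1 hσ
      obtain ⟨s', hs', rfl⟩ := Finset.mem_image.1 hσ'
      obtain ⟨ℓ, τ, h⟩ := hA hs
      obtain ⟨ℓ', τ', h'⟩ := hA hs'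
      exact hU.2 _ (hspec h).2.1 _ (hspec h').2.1 hp
    calc weightSum (fun s => (e s).map Prod.fst) t
        = ∑ s ∈ A, lenWeight ((e s).map Prod.fst) := by
          unfold weightSum
          refine (Finset.sum_subset (Finset.filter_subset _ _) fun s hs hs' => ?_).symm
          have : e s = none := by
            by_contra hne
            exact hs' (Finset.mem_filter.2 ⟨hs, Option.isSome_iff_ne_none.2 hne⟩)
          simp [this, lenWeight]
      _ = ∑ s ∈ A, (1 / 2 : ℝ) ^ (prog s).length := by
          refine Finset.sum_congr rfl fun s hs => ?_
          obtain ⟨ℓ, τ, h⟩ := hA hs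
          simp [h, lenWeight, (hspec h).1]
      _ = ∑ ρ ∈ A.image prog, (1 / 2 : ℝ) ^ ρ.length := 
          (Finset.sum_image (f := fun ρ : BStr => (1 / 2 : ℝ) ^ ρ.length) hinj).symm
      _ ≤ 1 := hpf.sum_le_one
  · have hex : ∃ k, Encodable.encode τ ∈ Nat.Partrec.Code.evaln k c (Encodable.encode ρ) :=
      Nat.Partrec.Code.evaln_complete.1 ((hev ρ τ).2 hτ)
    have hsome : ∃ k, (Nat.Partrec.Code.evaln k c (Encodable.encode ρ)).isSome := by
      obtain ⟨k, hk⟩ := hex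
      exact ⟨k, Option.isSome_iff_exists.2 ⟨_, hk⟩⟩
    obtain ⟨k, hk⟩ : ∃ k, Nat.find hsome = k + 1 := by
      refine Nat.exists_eq_succ_of_ne_zero fun h => ?_
      have := Nat.find_spec hsome
      rw [h] at this
      simp [Nat.Partrec.Code.evaln] at this
    refine ⟨Nat.pair k (Encodable.encode ρ), ?_⟩
    have h1 := Nat.find_min hsome (m := k) (by omega)
    have h2 := Nat.find_spec hsome
    rw [hk] at h2
    obtain ⟨y, hy⟩ := Option.isSome_iff_exists.1 h2
    have hy' : y = Encodable.encode τ :=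
      Part.mem_unique (Nat.Partrec.Code.evaln_sound hy) ((hev ρ τ).2 hτ)
    subst hy'
    have h1' : Nat.Partrec.Code.evaln k c (Encodable.encode ρ) = none := by simpa using h1
    simp [e, v, prog, h1', hy]

/-! ### Basic properties of prefix-free complexity -/

section Complexity

variable {U : BStr →. BStr}

lemma KM_le_of_mem {M : BStr →. BStr} {ρ σ : BStr} (h : σ ∈ M ρ) : KM M σ ≤ ρ.length :=
  sInf_le ⟨ρ, h, rfl⟩

lemma exists_length_eq_KM {M : BStr →. BStr} {σ : BStr} (h : KM M σ ≠ ⊤) :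
    ∃ ρ, σ ∈ M ρ ∧ (ρ.length : ℕ∞) = KM M σ := by
  have hne : ((fun ρ : BStr => (ρ.length : ℕ∞)) '' {ρ | σ ∈ M ρ}).Nonempty := by
    by_contra hempty
    rw [Set.not_nonempty_iff_eq_empty] at hempty
    exact h (by rw [KM, hempty, sInf_empty])
  obtain ⟨ρ, hρ, hl⟩ := csInf_mem hne
  exact ⟨ρ, hρ, hl⟩

lemma UniversalPFM.exists_KM_concat_le (hU : UniversalPFM U) :
    ∃ c : ℕ, ∀ σ b, KM U σ ≠ ⊤ → KM U (σ ++ [b]) ≤ KM U σ + c := by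
  let M : BStr →. BStr := fun p =>
    (p.head? : Part Bool).bind fun b => (U p.tail).map fun τ => τ ++ [b]
  have hM : PrefixFreeMachine M := by
    constructor
    · refine Partrec.bind (Primrec.list_head?.to_comp.ofOption) (Partrec.map
        (hU.1.1.comp (Primrec.list_tail.to_comp.comp Computable.fst)) ?_)
      exact (Primrec.list_concat.comp Primrec.snd (Primrec.snd.comp Primrec.fst)).to_comp
    · intro p hp p' hp' h
      cases p with
      | nil => simp [M] at hp
      | cons b p =>
        cases p' with
        | nil => simp at h
        | cons b' p' =>
          obtain ⟨rfl, h'⟩ := List.cons_prefix_cons.1 h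
          simp only [M, List.head?_cons, Part.coe_some, Part.bind_some, List.tail_cons,
            Set.mem_ofPred_eq] at hp hp'
          rw [hU.1.2 p hp p' hp' h']
  obtain ⟨c, hc⟩ := hU.2 M hM
  refine ⟨c + 1, fun σ b hσ => (hc _).trans ?_⟩
  obtain ⟨ρ, hρ, hl⟩ := exists_length_eq_KM hσ
  have : KM M (σ ++ [b]) ≤ (b :: ρ).length := KM_le_of_mem (by simpa [M] using hρ)
  rw [← hl]
  calc KM M (σ ++ [b]) + c ≤ ((b :: ρ).length : ℕ∞) + c := by gcongr
    _ = _ := by simp; ring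

lemma UniversalPFM.KM_ne_top (hU : UniversalPFM U) (σ : BStr) : KM U σ ≠ ⊤ := by
  induction σ using List.reverseRecOn with
  | nil =>
    let g : BStr → Option BStr := fun p => if p = [] then some [] else none
    have hM : PrefixFreeMachine (fun p => (g p : Part BStr)) := by
      constructor
      · exact (Primrec.ite (c := fun p : BStr => p = []) (Primrec.eq.comp Primrec.id
          (Primrec.const [])) (Primrec.const (some [])) (Primrec.const none)).to_comp.ofOption
      · have h (p : BStr) (hp : (g p : Part BStr).Dom) : p = [] := by
          by_contra hne
          simp [g, hne] at hp
        intro p hp p' hp' _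
        rw [h p hp, h p' hp']
    obtain ⟨c, hc⟩ := hU.2 _ hM
    have h0 : KM (fun p => (g p : Part BStr)) [] ≤ ([] : BStr).length :=
      KM_le_of_mem (by simp [g])
    refine ne_top_of_le_ne_top ?_ ((hc []).trans (add_le_add_left h0 _))
    simp
  | append_singleton σ b ih =>
    obtain ⟨c, hc⟩ := hU.exists_KM_concat_le
    exact ne_top_of_le_ne_top (by simp [ih]) (hc σ b ih)

lemma UniversalPFM.coe_Kof (hU : UniversalPFM U) (σ : BStr) : (Kof U σ : ℕ∞) = KM U σ :=
  ENat.natCast_toNat (hU.KM_ne_top σ)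

lemma UniversalPFM.exists_length_eq_Kof (hU : UniversalPFM U) (σ : BStr) :
    ∃ ρ, σ ∈ U ρ ∧ ρ.length = Kof U σ := by
  obtain ⟨ρ, hρ, hl⟩ := exists_length_eq_KM (hU.KM_ne_top σ)
  rw [← hU.coe_Kof] at hl
  exact ⟨ρ, hρ, by exact_mod_cast hl⟩

lemma UniversalPFM.exists_Kof_append_le (hU : UniversalPFM U) :
    ∃ c : ℕ, ∀ σ w, Kof U (σ ++ w) ≤ Kof U σ + c * w.length := by
  obtain ⟨c, hc⟩ := hU.exists_KM_concat_le
  refine ⟨c, fun σ w => ?_⟩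
  induction w using List.reverseRecOn with
  | nil => simp
  | append_singleton w b ih =>
    have h := hc (σ ++ w) b (hU.KM_ne_top _)
    rw [← hU.coe_Kof, ← hU.coe_Kof, List.append_assoc] at h
    have h' : Kof U (σ ++ (w ++ [b])) ≤ Kof U (σ ++ w) + c := by exact_mod_cast h
    rw [List.length_append, List.length_singleton, mul_add]
    omega

end Complexity

/-! ### The coding theorem -/

/-- The lengths of those entries of `e` whose output is mapped to `σ` by `g`. -/
def fiberLengths (e : ℕ → Option (ℕ × BStr)) (g : BStr → BStr) (σ : BStr) (s : ℕ) : Option ℕ :=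
  (e s).bind fun x => if g x.2 = σ then some x.1 else none

/-- A number `k` with `2^{-k} ≤ weightSum f t < 2^{1-k}`, when that sum lies in `(0, 1]`. -/
def sumLevel (f : ℕ → Option ℕ) (t : ℕ) : ℕ :=
  (dyadicSum f t).2 - Nat.findGreatest (fun j => 2 ^ j ≤ (dyadicSum f t).1) (dyadicSum f t).2

/-- A request for a description of `σ`, issued whenever the weight of the fiber over `σ` reaches a
new power of two. -/
def crossingRequest (e : ℕ → Option (ℕ × BStr)) (g : BStr → BStr) (s : ℕ) : Option (ℕ × BStr) :=
  (e s).bind fun x =>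
    if (dyadicSum (fiberLengths e g (g x.2)) s).1 *
        2 ^ sumLevel (fiberLengths e g (g x.2)) (s + 1) <
        2 ^ (dyadicSum (fiberLengths e g (g x.2)) s).2 then
      some (sumLevel (fiberLengths e g (g x.2)) (s + 1) + 1, g x.2)
    else none

lemma primrec_fiberLengths {e : ℕ → Option (ℕ × BStr)} {g : BStr → BStr} (he : Primrec e)
    (hg : Primrec g) : Primrec₂ (fiberLengths e g) := by
  refine Primrec.option_bind (he.comp Primrec.snd)
    (g := fun (y : BStr × ℕ) (x : ℕ × BStr) => if g x.2 = y.1 then some x.1 else none) ?_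
  exact Primrec.ite (c := fun z : (BStr × ℕ) × (ℕ × BStr) => g z.2.2 = z.1.1)
    (Primrec.eq.comp (hg.comp (Primrec.snd.comp Primrec.snd)) (Primrec.fst.comp Primrec.fst))
    (Primrec.option_some.comp (Primrec.fst.comp Primrec.snd)) (Primrec.const none)

lemma primrec_sumLevel {α : Type*} [Primcodable α] {f : α → ℕ → Option ℕ} (hf : Primrec₂ f) :
    Primrec₂ (fun a t => sumLevel (f a) t) := by
  have hd : Primrec (fun x : α × ℕ => dyadicSum (f x.1) x.2) := primrec_dyadicSum hf
  refine Primrec.nat_sub.comp (Primrec.snd.comp hd)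
    (Primrec.nat_findGreatest (p := fun (x : α × ℕ) j => 2 ^ j ≤ (dyadicSum (f x.1) x.2).1)
      (Primrec.snd.comp hd) ?_)
  exact Primrec.nat_le.comp (primrec_two_pow.comp Primrec.snd)
    (Primrec.fst.comp (hd.comp Primrec.fst))

lemma primrec_crossingRequest {e : ℕ → Option (ℕ × BStr)} {g : BStr → BStr} (he : Primrec e)
    (hg : Primrec g) : Primrec (crossingRequest e g) := by
  have hf := primrec_fiberLengths he hg
  have hσ : Primrec (fun z : ℕ × (ℕ × BStr) => g z.2.2) :=
    hg.comp (Primrec.snd.comp Primrec.snd)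
  have hd : Primrec (fun z : ℕ × (ℕ × BStr) => dyadicSum (fiberLengths e g (g z.2.2)) z.1) :=
    (primrec_dyadicSum hf).comp hσ Primrec.fst
  have hk : Primrec (fun z : ℕ × (ℕ × BStr) => sumLevel (fiberLengths e g (g z.2.2)) (z.1 + 1)) :=
    (primrec_sumLevel hf).comp hσ (Primrec.succ.comp Primrec.fst)
  refine Primrec.option_bind he (g := fun (s : ℕ) (x : ℕ × BStr) =>
    if (dyadicSum (fiberLengths e g (g x.2)) s).1 *
        2 ^ sumLevel (fiberLengths e g (g x.2)) (s + 1) <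
        2 ^ (dyadicSum (fiberLengths e g (g x.2)) s).2 then
      some (sumLevel (fiberLengths e g (g x.2)) (s + 1) + 1, g x.2)
    else none) ?_
  exact Primrec.ite (c := fun z : ℕ × (ℕ × BStr) =>
      (dyadicSum (fiberLengths e g (g z.2.2)) z.1).1 *
        2 ^ sumLevel (fiberLengths e g (g z.2.2)) (z.1 + 1) <
        2 ^ (dyadicSum (fiberLengths e g (g z.2.2)) z.1).2)
    (Primrec.nat_lt.comp (Primrec.nat_mul.comp (Primrec.fst.comp hd) (primrec_two_pow.comp hk))
      (primrec_two_pow.comp (Primrec.snd.comp hd)))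
    (Primrec.option_some.comp (Primrec.pair (Primrec.succ.comp hk) hσ)) (Primrec.const none)

lemma sumLevel_spec {f : ℕ → Option ℕ} {t : ℕ} (h0 : 0 < weightSum f t) (h1 : weightSum f t ≤ 1) :
    (1 / 2) ^ sumLevel f t ≤ weightSum f t ∧ weightSum f t < 2 * (1 / 2) ^ sumLevel f t := by
  have hS := dyadicSum_eq f t
  unfold sumLevel
  set a := (dyadicSum f t).1
  set E := (dyadicSum f t).2
  set j := Nat.findGreatest (fun j => 2 ^ j ≤ a) E with hj
  have hE : (0 : ℝ) < 2 ^ E := by positivity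
  have ha : 0 < a := by
    have : (0 : ℝ) < a := by rw [hS]; positivity
    exact_mod_cast this
  have hja : 2 ^ j ≤ a := Nat.findGreatest_spec (P := fun j => 2 ^ j ≤ a) (Nat.zero_le E)
    (by simpa using Nat.succ_le_of_lt ha)
  have hjE : j ≤ E := Nat.findGreatest_le E
  have hpow : ((1 : ℝ) / 2) ^ (E - j) * 2 ^ E = 2 ^ j := by
    obtain ⟨i, hi⟩ := Nat.exists_eq_add_of_le hjE
    rw [hi, Nat.add_sub_cancel_left, pow_add, one_div, inv_pow]
    field_simp
  have hja' : (2 : ℝ) ^ j ≤ a := by exact_mod_cast hja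
  constructor
  · refine le_of_mul_le_mul_right ?_ hE
    rw [hpow, ← hS]
    exact hja'
  · rcases hjE.lt_or_eq with hlt | heq
    · have h := Nat.findGreatest_is_greatest (P := fun j => 2 ^ j ≤ a) (n := E) (k := j + 1)
        (by omega) (by omega)
      have h' : (a : ℝ) < 2 ^ (j + 1) := by exact_mod_cast not_le.1 h
      refine lt_of_mul_lt_mul_right ?_ hE.le
      rw [mul_assoc, hpow, ← hS]
      linarith [pow_succ (2 : ℝ) j]
    · rw [heq]
      simp
      linarith

lemma half_pow_add_half_pow_le {j k : ℕ} (h : ((1 : ℝ) / 2) ^ j < (1 / 2) ^ k) :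
    2 * ((1 : ℝ) / 2) ^ j ≤ (1 / 2) ^ k := by
  have hlt : k < j := by
    by_contra hle
    exact absurd h (not_lt.2 (pow_le_pow_of_le_one (by norm_num) (by norm_num) (not_lt.1 hle)))
  have := pow_le_pow_of_le_one (a := (1 : ℝ) / 2) (by norm_num) (by norm_num)
    (show k + 1 ≤ j from hlt)
  rw [pow_succ] at this
  linarith

/-- If `W` grows by `2^{-(k+1)}` exactly when the nondecreasing sequence `S` crosses a power
`2^{-k}`, then `W ≤ S`, and the last power crossed is within a factor `2` of `S`. -/
lemma crossing_bounds {S W : ℕ → ℝ} {R : ℕ → Prop} (hS0 : S 0 = 0) (hW0 : W 0 = 0)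
    (hS : Monotone S)
    (hstep : ∀ t, (S (t + 1) = S t ∧ W (t + 1) = W t) ∨
      ∃ k : ℕ, (1 / 2) ^ k ≤ S (t + 1) ∧ S (t + 1) < 2 * (1 / 2) ^ k ∧
        ((S t < (1 / 2) ^ k ∧ W (t + 1) = W t + (1 / 2) ^ (k + 1) ∧ R k) ∨
          ((1 / 2) ^ k ≤ S t ∧ W (t + 1) = W t))) (t : ℕ) :
    W t ≤ S t ∧ (0 < S t → ∃ k, R k ∧ S t < 2 * (1 / 2) ^ k) := by
  have hI : ∀ t, W t ≤ S t ∧ ∀ k : ℕ, S t < (1 / 2) ^ k → W t ≤ (1 / 2) ^ (k + 1) := by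
    intro t
    induction t with
    | zero => rw [hS0, hW0]; exact ⟨le_rfl, fun k _ => by positivity⟩
    | succ t ih =>
      have hm := hS (Nat.le_succ t)
      rcases hstep t with ⟨h1, h2⟩ | ⟨k, h1, h2, ⟨h3, h4, -⟩ | ⟨h3, h4⟩⟩
      · rw [h1, h2]; exact ih
      · have hw := ih.2 k h3
        rw [pow_succ] at h4 hw
        refine ⟨by linarith, fun j hj => ?_⟩
        have := half_pow_add_half_pow_le (h1.trans_lt hj)
        rw [pow_succ]
        linarith
      · rw [h4]
        exact ⟨ih.1.trans hm, fun j hj => ih.2 j (hm.trans_lt hj)⟩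
  refine ⟨(hI t).1, ?_⟩
  induction t with
  | zero => intro h; rw [hS0] at h; exact (lt_irrefl _ h).elim
  | succ t ih =>
    intro hpos
    rcases hstep t with ⟨h1, h2⟩ | ⟨k, h1, h2, ⟨h3, h4, h5⟩ | ⟨h3, h4⟩⟩
    · rw [h1] at hpos ⊢; exact ih hpos
    · exact ⟨k, h5, h2⟩
    · obtain ⟨j, hj, hj'⟩ := ih (lt_of_lt_of_le (by positivity) h3)
      refine ⟨j, hj, ?_⟩
      by_contra hcon
      push Not at hcon
      have h6 : ((1 : ℝ) / 2) ^ j < (1 / 2) ^ k := by linarith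
      have := half_pow_add_half_pow_le h6
      linarith

lemma lenWeight_fiberLengths (e : ℕ → Option (ℕ × BStr)) (g : BStr → BStr) (σ : BStr) (s : ℕ) :
    lenWeight (fiberLengths e g σ s) =
      if ((e s).map (g ∘ Prod.snd)).getD [] = σ then lenWeight ((e s).map Prod.fst) else 0 := by
  unfold fiberLengths
  rcases e s with _ | ⟨ℓ, τ⟩
  · simp [lenWeight]
  · by_cases h : g τ = σ <;> simp [h, lenWeight]

/-- **Coding theorem**: the programs whose output is mapped to `σ` by `g` have total weight
`O(2^{-K(σ)})`. -/
lemma UniversalPFM.exists_weightSum_fiber_le {U : BStr →. BStr} (hU : UniversalPFM U)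
    {e : ℕ → Option (ℕ × BStr)} (he : Primrec e)
    (hw : ∀ t, weightSum (fun s => (e s).map Prod.fst) t ≤ 1) {g : BStr → BStr} (hg : Primrec g) :
    ∃ d : ℕ, ∀ σ t, weightSum (fiberLengths e g σ) t * 2 ^ Kof U σ ≤ 2 ^ d := by
  let o : ℕ → BStr := fun s => ((e s).map (g ∘ Prod.snd)).getD []
  let r := crossingRequest e g
  let rl : ℕ → ℝ := fun s => lenWeight ((r s).map Prod.fst)
  let S : BStr → ℕ → ℝ := fun σ => weightSum (fiberLengths e g σ)
  let W : BStr → ℕ → ℝ := fun σ t => ∑ s ∈ Finset.range t, if o s = σ then rl s else 0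
  have hSle (σ : BStr) (t : ℕ) : S σ t ≤ 1 := by
    refine le_trans (Finset.sum_le_sum fun s _ => ?_) (hw t)
    rw [lenWeight_fiberLengths]
    split_ifs
    · exact le_rfl
    · exact lenWeight_nonneg _
  have hstep (σ : BStr) (t : ℕ) : (S σ (t + 1) = S σ t ∧ W σ (t + 1) = W σ t) ∨
      ∃ k : ℕ, (1 / 2) ^ k ≤ S σ (t + 1) ∧ S σ (t + 1) < 2 * (1 / 2) ^ k ∧
        ((S σ t < (1 / 2) ^ k ∧ W σ (t + 1) = W σ t + (1 / 2) ^ (k + 1) ∧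
            ∃ s, r s = some (k + 1, σ)) ∨
          ((1 / 2) ^ k ≤ S σ t ∧ W σ (t + 1) = W σ t)) := by
    have hS1 : S σ (t + 1) = S σ t + lenWeight (fiberLengths e g σ t) := weightSum_succ _ _
    have hW1 : W σ (t + 1) = W σ t + if o t = σ then rl t else 0 := Finset.sum_range_succ _ _
    rw [lenWeight_fiberLengths] at hS1
    by_cases ho : o t = σ
    swap
    · left
      rw [if_neg ho] at hS1 hW1
      exact ⟨by simpa using hS1, by simpa using hW1⟩
    rw [if_pos ho] at hS1 hW1
    rcases het : e t with _ | ⟨ℓ, τ⟩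
    · left
      have hrt : r t = none := by simp [r, crossingRequest, het]
      simp only [rl, hrt, het, Option.map_none, lenWeight, add_zero] at hS1 hW1
      exact ⟨hS1, hW1⟩
    · right
      have hσ : g τ = σ := by simpa [o, het] using ho
      have hpos : 0 < S σ (t + 1) := by
        have h0 : 0 ≤ S σ t := weightSum_nonneg _ _
        simp only [het, Option.map_some, lenWeight] at hS1
        rw [hS1]
        positivity
      obtain ⟨h1, h2⟩ := sumLevel_spec hpos (hSle σ (t + 1))
      refine ⟨_, h1, h2, ?_⟩
      set k := sumLevel (fiberLengths e g σ) (t + 1) with hk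
      have hcond : (dyadicSum (fiberLengths e g σ) t).1 * 2 ^ k <
          2 ^ (dyadicSum (fiberLengths e g σ) t).2 ↔ S σ t < (1 / 2) ^ k := by
        have hE : (0 : ℝ) < 2 ^ (dyadicSum (fiberLengths e g σ) t).2 := by positivity
        rw [← Nat.cast_lt (α := ℝ)]
        push_cast
        rw [dyadicSum_eq, one_div, inv_pow, ← one_div, lt_div_iff₀ (by positivity)]
        constructor <;> intro h <;> nlinarith
      have hr : r t = if S σ t < (1 / 2) ^ k then some (k + 1, σ) else none := by
        simp only [r, crossingRequest, het, Option.bind_some, hσ]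
        simp only [← hk, hcond]
      by_cases hlt : S σ t < (1 / 2) ^ k
      · rw [if_pos hlt] at hr
        left
        refine ⟨hlt, ?_, t, hr⟩
        rw [hW1]
        simp [rl, hr, lenWeight]
      · rw [if_neg hlt] at hr
        right
        refine ⟨not_lt.1 hlt, ?_⟩
        rw [hW1]
        simp [rl, hr, lenWeight]
  have hb (σ : BStr) := crossing_bounds (S := S σ) (W := W σ) (by simp [S, weightSum])
    (by simp [W]) (weightSum_mono _) (hstep σ)
  have hrw (t : ℕ) : weightSum (fun s => (r s).map Prod.fst) t ≤ 1 := by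
    let T := (Finset.range t).image o
    have hfib (f : ℕ → ℝ) : ∑ s ∈ Finset.range t, f s =
        ∑ σ ∈ T, ∑ s ∈ Finset.range t, if o s = σ then f s else 0 := by
      rw [Finset.sum_comm]
      refine Finset.sum_congr rfl fun s hs => ?_
      rw [Finset.sum_ite_eq, if_pos (Finset.mem_image_of_mem o hs)]
    calc weightSum (fun s => (r s).map Prod.fst) t = ∑ σ ∈ T, W σ t := hfib rl
      _ ≤ ∑ σ ∈ T, S σ t := Finset.sum_le_sum fun σ _ => (hb σ t).1
      _ = weightSum (fun s => (e s).map Prod.fst) t := by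
        rw [weightSum, hfib]
        refine Finset.sum_congr rfl fun σ _ => Finset.sum_congr rfl fun s _ => ?_
        exact lenWeight_fiberLengths e g σ s
      _ ≤ 1 := hw t
  obtain ⟨c, hc⟩ := hU.exists_forall_KM_le (primrec_crossingRequest he hg) hrw
  refine ⟨c + 2, fun σ t => ?_⟩
  rcases (show 0 ≤ S σ t from weightSum_nonneg _ _).eq_or_lt with h0 | hpos
  · change S σ t * _ ≤ _
    rw [← h0]
    simp
  · obtain ⟨k, ⟨s, hs⟩, hk⟩ := (hb σ t).2 hpos
    have hK : Kof U σ ≤ k + 1 + c := by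
      have := hc s _ _ hs
      rw [← hU.coe_Kof] at this
      exact_mod_cast this
    calc S σ t * 2 ^ Kof U σ ≤ (2 * (1 / 2) ^ k) * 2 ^ (k + 1 + c) := by
          gcongr
          · norm_num
      _ = 2 ^ (c + 2) := by
          rw [one_div, inv_pow, pow_add, pow_add, pow_add]
          field_simp

/-! ### Block-wise conditional coding -/

/-- Conditional requests: given `(σ, k)`, every program of length `ℓ` whose output `τ` is mapped to
`σ` by `g` requests a code word for `(τ, ℓ)` of length `ℓ + d - k`. -/
def blockRequest (e : ℕ → Option (ℕ × BStr)) (g : BStr → BStr) (d : ℕ) (a : BStr × ℕ) (s : ℕ) :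
    Option (ℕ × BStr × ℕ) :=
  (e s).bind fun x => if g x.2 = a.1 then some (x.1 + d - a.2, x.2, x.1) else none

/-- The lengths requested by `blockRequest`. -/
def blockLengths (e : ℕ → Option (ℕ × BStr)) (g : BStr → BStr) (d : ℕ) (a : BStr × ℕ) (s : ℕ) :
    Option ℕ :=
  (blockRequest e g d a s).map Prod.fst

/-- Given `(σ, k, p)`, read the code word at the beginning of `p` and return the pair `(τ, ℓ)` that
it describes together with the rest of `p`. -/
def decodeBlock (e : ℕ → Option (ℕ × BStr)) (g : BStr → BStr) (d : ℕ) :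
    BStr × ℕ × BStr →. BStr × ℕ × BStr := fun x =>
  Nat.rfindOpt fun t => (blockRequest e g d (x.1, x.2.1) t).bind fun y =>
    if isCode (blockLengths e g d (x.1, x.2.1)) t (x.2.2.take (y.1 + 1)) = true then
      some (y.2.1, y.2.2, x.2.2.drop (y.1 + 1))
    else none

section Blocks

variable {e : ℕ → Option (ℕ × BStr)} {g : BStr → BStr}

lemma primrec_blockRequest (he : Primrec e) (hg : Primrec g) (d : ℕ) :
    Primrec₂ (blockRequest e g d) := by
  refine Primrec.option_bind (he.comp Primrec.snd)
    (g := fun (z : (BStr × ℕ) × ℕ) (x : ℕ × BStr) =>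
      if g x.2 = z.1.1 then some (x.1 + d - z.1.2, x.2, x.1) else none) ?_
  refine Primrec.ite (c := fun w : ((BStr × ℕ) × ℕ) × (ℕ × BStr) => g w.2.2 = w.1.1.1)
    (Primrec.eq.comp (hg.comp (Primrec.snd.comp Primrec.snd))
      (Primrec.fst.comp (Primrec.fst.comp Primrec.fst)))
    (Primrec.option_some.comp (Primrec.pair ?_ (Primrec.pair (Primrec.snd.comp Primrec.snd)
      (Primrec.fst.comp Primrec.snd)))) (Primrec.const none)
  exact Primrec.nat_sub.comp
    (Primrec.nat_add.comp (Primrec.fst.comp Primrec.snd) (Primrec.const d))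
    (Primrec.snd.comp (Primrec.fst.comp Primrec.fst))

lemma primrec_blockLengths (he : Primrec e) (hg : Primrec g) (d : ℕ) :
    Primrec₂ (blockLengths e g d) :=
  Primrec.option_map (primrec_blockRequest he hg d) (Primrec.fst.comp Primrec.snd)

lemma partrec_decodeBlock (he : Primrec e) (hg : Primrec g) (d : ℕ) :
    Partrec (decodeBlock e g d) := by
  let A := BStr × ℕ × BStr
  have ha : Primrec (fun z : A × ℕ => (z.1.1, z.1.2.1)) :=
    Primrec.pair (Primrec.fst.comp Primrec.fst)
      (Primrec.fst.comp (Primrec.snd.comp Primrec.fst))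
  have hp : Primrec (fun z : (A × ℕ) × (ℕ × BStr × ℕ) => z.1.1.2.2) :=
    Primrec.snd.comp (Primrec.snd.comp (Primrec.fst.comp Primrec.fst))
  have hl : Primrec (fun z : (A × ℕ) × (ℕ × BStr × ℕ) => z.2.1 + 1) :=
    Primrec.succ.comp (Primrec.fst.comp Primrec.snd)
  refine Partrec.rfindOpt (f := fun (x : A) t =>
    (blockRequest e g d (x.1, x.2.1) t).bind fun y =>
      if isCode (blockLengths e g d (x.1, x.2.1)) t (x.2.2.take (y.1 + 1)) = true then
        some (y.2.1, y.2.2, x.2.2.drop (y.1 + 1))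
      else none) (Primrec.to_comp ?_)
  refine Primrec.option_bind ((primrec_blockRequest he hg d).comp ha Primrec.snd)
    (g := fun (z : A × ℕ) (y : ℕ × BStr × ℕ) =>
      if isCode (blockLengths e g d (z.1.1, z.1.2.1)) z.2 (z.1.2.2.take (y.1 + 1)) = true then
        some (y.2.1, y.2.2, z.1.2.2.drop (y.1 + 1))
      else none) ?_
  refine Primrec.ite (c := fun z : (A × ℕ) × (ℕ × BStr × ℕ) =>
      isCode (blockLengths e g d (z.1.1.1, z.1.1.2.1)) z.1.2 (z.1.1.2.2.take (z.2.1 + 1)) = true)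
    (Primrec.eq.comp ((primrec_isCode (primrec_blockLengths he hg d)).comp
      (Primrec.pair (ha.comp Primrec.fst) (Primrec.pair (Primrec.snd.comp Primrec.fst)
        (Primrec.list_take.comp hl hp)))) (Primrec.const true))
    (Primrec.option_some.comp (Primrec.pair (Primrec.fst.comp (Primrec.snd.comp Primrec.snd))
      (Primrec.pair (Primrec.snd.comp (Primrec.snd.comp Primrec.snd))
        (Primrec.list_drop.comp hl hp)))) (Primrec.const none)

lemma mem_decodeBlock {d k t ℓ ℓ' : ℕ} {σ τ p : BStr}
    (ht : blockRequest e g d (σ, k) t = some (ℓ, τ, ℓ')) (hl : p.length = ℓ + 1)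
    (hp : isCode (blockLengths e g d (σ, k)) t p = true) (q : BStr) :
    (τ, ℓ', q) ∈ decodeBlock e g d (σ, k, p ++ q) := by
  have hdom : (decodeBlock e g d (σ, k, p ++ q)).Dom := by
    refine Nat.rfindOpt_dom.2 ⟨t, (τ, ℓ', q), ?_⟩
    simp [ht, ← hl, hp]
  obtain ⟨x, hx⟩ := Part.dom_iff_mem.1 hdom
  obtain ⟨t', ht'⟩ := Nat.rfindOpt_spec hx
  obtain ⟨⟨m, τ', m'⟩, hy, hy'⟩ := Option.bind_eq_some_iff.1 ht'
  simp only at hy hy'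
  split_ifs at hy' with hc
  have htt : t = t' := by
    rcases List.prefix_or_prefix_of_prefix (List.prefix_append p q)
      (List.take_prefix (m + 1) (p ++ q)) with h | h
    · exact isCode_unique hp hc h
    · exact (isCode_unique hc hp h).symm
  subst htt
  rw [ht] at hy
  cases hy
  have : x = (τ, ℓ', q) := by
    rw [← Option.some_inj, ← hy', ← hl]
    simp
  rw [← this]
  exact hx

/-- **Chain rule**: given `σ` and `K(σ)`, a string `τ` with `g τ = σ` has a self-delimiting
description of length `K(τ) - K(σ) + O(1)`. -/
lemma UniversalPFM.exists_decodeBlock {U : BStr →. BStr} (hU : UniversalPFM U) (hg : Primrec g) :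
    ∃ (D : BStr × ℕ × BStr →. BStr × ℕ × BStr) (c : ℕ), Partrec D ∧
      ∀ τ, ∃ p : BStr, p.length + Kof U (g τ) = Kof U τ + c ∧ 1 ≤ p.length ∧
        ∀ q, (τ, Kof U τ, q) ∈ D (g τ, Kof U (g τ), p ++ q) := by
  obtain ⟨e, he, hw, hen⟩ := hU.1.exists_enum
  obtain ⟨d, hd⟩ := hU.exists_weightSum_fiber_le he hw hg
  refine ⟨decodeBlock e g d, d + 1, partrec_decodeBlock he hg d, fun τ => ?_⟩
  obtain ⟨ρ, hρ, hρl⟩ := hU.exists_length_eq_Kof τ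
  obtain ⟨t, ht⟩ := hen ρ τ hρ
  rw [hρl] at ht
  set σ := g τ with hσ
  set k := Kof U σ
  have hle (s ℓ : ℕ) (hs : fiberLengths e g σ s = some ℓ) : k ≤ ℓ + d := by
    have h1 := hd σ (s + 1)
    have h2 := weightSum_nonneg (fiberLengths e g σ) s
    rw [weightSum_succ, hs, lenWeight] at h1
    have h3 : ((1 : ℝ) / 2) ^ ℓ * 2 ^ k ≤ 2 ^ d := by
      refine le_trans ?_ h1
      gcongr
      linarith
    have h4 : (2 : ℝ) ^ k ≤ 2 ^ (ℓ + d) := by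
      rw [one_div, inv_pow, inv_mul_le_iff₀ (by positivity)] at h3
      rwa [pow_add]
    exact (pow_le_pow_iff_right₀ (by norm_num)).1 h4
  have hterm (s : ℕ) : lenWeight (blockLengths e g d (σ, k) s) =
      lenWeight (fiberLengths e g σ s) * (2 ^ k / 2 ^ d) := by
    have hb : blockLengths e g d (σ, k) s = (fiberLengths e g σ s).map (fun ℓ => ℓ + d - k) := by
      simp only [blockLengths, blockRequest, fiberLengths]
      rcases e s with _ | ⟨ℓ, τ'⟩
      · rfl
      · by_cases h : g τ' = σ <;> simp [h]
    rw [hb]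
    rcases hs : fiberLengths e g σ s with _ | ℓ
    · simp [lenWeight]
    · obtain ⟨i, hi⟩ := Nat.exists_eq_add_of_le (hle s ℓ hs)
      simp only [Option.map_some, lenWeight, hi, Nat.add_sub_cancel_left, one_div, inv_pow]
      have : (2 : ℝ) ^ ℓ * 2 ^ d = 2 ^ k * 2 ^ i := by rw [← pow_add, ← pow_add, hi]
      field_simp
      linarith
  have hsum (s : ℕ) : weightSum (blockLengths e g d (σ, k)) s ≤ 1 := by
    have : weightSum (blockLengths e g d (σ, k)) s =
        weightSum (fiberLengths e g σ) s * (2 ^ k / 2 ^ d) := by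
      simp only [weightSum, hterm, Finset.sum_mul]
    rw [this, ← mul_div_assoc, div_le_one (by positivity)]
    exact hd σ s
  have hreq : blockRequest e g d (σ, k) t = some (Kof U τ + d - k, τ, Kof U τ) := by
    simp [blockRequest, ht, ← hσ]
  have hk : k ≤ Kof U τ + d := hle t _ (by simp [fiberLengths, ht, ← hσ])
  obtain ⟨p, hp, hpc⟩ := exists_isCode (f := blockLengths e g d (σ, k)) (t := t)
    (ℓ := Kof U τ + d - k) (by simp [blockLengths, hreq]) (hsum _)
  exact ⟨p, by omega, by omega, mem_decodeBlock hreq hp hpc⟩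

end Blocks

/-! ### Streams -/

lemma length_stake (X : ℕ → Bool) (n : ℕ) : (stake X n).length = n := by simp [stake]

lemma take_stake (X : ℕ → Bool) {m n : ℕ} (h : m ≤ n) : (stake X n).take m = stake X m := by
  simp [stake, ← List.map_take, List.take_range, h]

/-- An increasing chain of strings of unbounded length has a limit stream. -/
lemma exists_stream_of_chain (P : ℕ → BStr) (hP : ∀ j, P j <+: P (j + 1))
    (hl : ∀ j, j ≤ (P j).length) :
    ∃ Y : ℕ → Bool, ∀ j n, (P j).length ≤ n → P j <+: stake Y n := by
  have hmono {i j : ℕ} (h : i ≤ j) : P i <+: P j := by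
    induction j, h using Nat.le_induction with
    | base => exact List.prefix_refl _
    | succ j _ ih => exact ih.trans (hP j)
  refine ⟨fun i => (P (i + 1)).getD i false, fun j n hn => ?_⟩
  rw [List.prefix_iff_getElem?]
  intro i hi
  have hi' : i < (P (i + 1)).length := hl (i + 1)
  have hget : (P (i + 1))[i] = (P j)[i] := by
    rcases le_total j (i + 1) with h | h
    · exact ((hmono h).getElem hi).symm
    · exact (hmono h).getElem hi'
  have hin : i < n := by omega
  simp [stake, hin, List.getElem?_eq_getElem hi', hget]

/-- The prefix of `τ` of length `(⌊√|τ|⌋ - 1)²`. -/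
def sqTake (τ : BStr) : BStr :=
  τ.take ((Nat.sqrt τ.length - 1) * (Nat.sqrt τ.length - 1))

lemma primrec_sqTake : Primrec sqTake := by
  have h : Primrec (fun τ : BStr => Nat.sqrt τ.length - 1) :=
    Primrec.pred.comp (Primrec.nat_sqrt.comp Primrec.list_length)
  exact Primrec.list_take.comp (Primrec.nat_mul.comp h h) Primrec.id

lemma sqTake_stake (X : ℕ → Bool) (i : ℕ) :
    sqTake (stake X ((i + 1) * (i + 1))) = stake X (i * i) := by
  rw [sqTake, length_stake, Nat.sqrt_eq, Nat.add_sub_cancel]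
  exact take_stake X (by nlinarith)

/-- There is a constant `c` such that every stream `X` is computable from some stream
`Y` with oracle-use `n ↦ K(X↾n) + c·(⌊√n⌋ + 1)`. -/
theorem stmt16 (U : BStr →. BStr) (hU : UniversalPFM U) :
    ∃ c : ℕ, ∀ X : ℕ → Bool, ∃ Y : ℕ → Bool,
      ComputableWithUse X Y (fun n => Kof U (stake X n) + c * (Nat.sqrt n + 1)) := by
  obtain ⟨D, d, hD, hcode⟩ := hU.exists_decodeBlock primrec_sqTake
  obtain ⟨b, hb⟩ := hU.exists_Kof_append_le
  refine ⟨d + 2 * b, fun X => ?_⟩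
  let σ : ℕ → BStr := fun i => stake X (i * i)
  have hp (i : ℕ) : ∃ p : BStr, p.length + Kof U (σ i) = Kof U (σ (i + 1)) + d ∧ 1 ≤ p.length ∧
      ∀ q, (σ (i + 1), Kof U (σ (i + 1)), q) ∈ D (σ i, Kof U (σ i), p ++ q) := by
    have h := hcode (σ (i + 1))
    rwa [sqTake_stake X i] at h
  choose p hpl hp1 hpD using hp
  let P : ℕ → BStr := fun j => Nat.rec [] (fun i w => w ++ p i) j
  have hPs (j : ℕ) : P (j + 1) = P j ++ p j := rfl
  have hP0 : P 0 = [] := rfl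
  have hPl (j : ℕ) : j ≤ (P j).length ∧ (P j).length + Kof U (σ 0) = Kof U (σ j) + d * j := by
    induction j with
    | zero => simp [hP0]
    | succ j ih =>
      have h1 := hpl j
      have h2 := hp1 j
      rw [hPs, List.length_append, mul_add]
      omega
  obtain ⟨Y, hY⟩ := exists_stream_of_chain P (fun j => List.prefix_append _ _)
    (fun j => (hPl j).1)
  let k₀ := Kof U (σ 0)
  let iter : BStr → ℕ → Part (BStr × ℕ × BStr) := fun w j =>
    Nat.rec (Part.some ([], k₀, w)) (fun _ s => s.bind D) j
  have hiter (j : ℕ) : ∀ q, (σ j, Kof U (σ j), q) ∈ iter (P j ++ q) j := by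
    induction j with
    | zero => intro q; exact Part.mem_some _
    | succ j ih =>
      intro q
      rw [hPs, List.append_assoc]
      exact Part.mem_bind (ih (p j ++ q)) (hpD j q)
  refine ⟨Y, fun x => (iter x.2 (Nat.sqrt x.1 + 1)).map fun s => s.1.take x.1, ?_, fun n => ?_⟩
  · refine Partrec.map (f := fun x : ℕ × BStr => iter x.2 (Nat.sqrt x.1 + 1)) ?_ ?_
    · refine Partrec.nat_rec (f := fun x : ℕ × BStr => Nat.sqrt x.1 + 1)
        (g := fun x => Part.some ([], k₀, x.2)) (h := fun _ y => D y.2)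
        (Primrec.succ.comp (Primrec.nat_sqrt.comp Primrec.fst)).to_comp ?_ ?_
      · exact (Primrec.pair (Primrec.const []) (Primrec.pair (Primrec.const k₀)
          Primrec.snd)).to_comp
      · exact hD.comp (Primrec.snd.comp Primrec.snd).to_comp
    · exact (Primrec.list_take.comp (Primrec.fst.comp Primrec.fst)
        (Primrec.fst.comp Primrec.snd)).to_comp
  · set m := Nat.sqrt n with hm
    have hn1 : n < (m + 1) * (m + 1) := Nat.lt_succ_sqrt n
    have hn2 : m * m ≤ n := Nat.sqrt_le n
    have htake : (σ (m + 1)).take n = stake X n := take_stake X hn1.le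
    have hK : Kof U (σ (m + 1)) ≤ Kof U (stake X n) + b * (2 * (m + 1)) := by
      have h := hb (stake X n) ((σ (m + 1)).drop n)
      rw [← htake, List.take_append_drop, List.length_drop, length_stake, htake] at h
      refine h.trans ?_
      gcongr
      have : (m + 1) * (m + 1) = m * m + 2 * m + 1 := by ring
      omega
    have hlen : (P (m + 1)).length ≤ Kof U (stake X n) + (d + 2 * b) * (m + 1) := by
      have := (hPl (m + 1)).2
      nlinarith
    obtain ⟨q, hq⟩ := hY (m + 1) _ hlen
    refine (Part.mem_map_iff _).2 ⟨(σ (m + 1), Kof U (σ (m + 1)), q), ?_, htake⟩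
    have h := hiter (m + 1) q
    rw [hq] at h
    exact h
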